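/- arXiv:1511.08772 — 5 statements merged into one kernel-verified Lean document; each statement's English description precedes it below -/
import Mathlib

section
/- Let B and R be C4-free simple graphs on the same finite vertex set V, and suppose that R is also C5-free. If G(B,R) is the complete graph on V, then V is obedient, i.e., there exist a clique X of B and a clique Y of R with V = X ∪ Y. -/
/-- A graph is `C4`-free: it has no induced cycle on four vertices. -/
def IsC4Free {V : Type*} (G : SimpleGraph V) : Prop :=
  ¬ ∃ a b c d : V, a ≠ c ∧ b ≠ d ∧
    G.Adj a b ∧ G.Adj b c ∧ G.Adj c d ∧ G.Adj d a ∧ ¬ G.Adj a c ∧ ¬ G.Adj b d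

/-- A graph is `C5`-free: it has no induced cycle on five vertices. -/
def IsC5Free {V : Type*} (G : SimpleGraph V) : Prop :=
  ¬ ∃ v : Fin 5 → V, Function.Injective v ∧
    (∀ i, G.Adj (v i) (v (i + 1))) ∧ (∀ i, ¬ G.Adj (v i) (v (i + 2)))

/-- A set `U` is obedient (w.r.t. `B` and `R`) if it is the union of a
`B`-clique and an `R`-clique. -/
def Obedient {V : Type*} (B R : SimpleGraph V) (U : Set V) : Prop :=
  ∃ X Y : Set V, B.IsClique X ∧ R.IsClique Y ∧ U = X ∪ Y

/-- If no two non-`B`-neighbours of `v` are non-adjacent in `R`, an obedient set stays obedient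
when `v` is added to it. -/
lemma Obedient.insert_of_nonadj {V : Type*} {B R : SimpleGraph V}
    (hB : IsC4Free B) (hR : IsC4Free R) (hBR : ∀ x y, x ≠ y → B.Adj x y ∨ R.Adj x y) {v : V}
    (hv : ∀ p q, v ≠ p → v ≠ q → ¬ B.Adj v p → ¬ B.Adj v q → p ≠ q → R.Adj p q)
    {U : Set V} (hU : Obedient B R U) : Obedient B R (insert v U) := by
  by_cases hvU : v ∈ U
  · rwa [Set.insert_eq_of_mem hvU]
  obtain ⟨X, Y, hX, hY, rfl⟩ := hU
  have ne_of_mem_left : ∀ x ∈ X, v ≠ x := fun x hx h => hvU (Or.inl (h ▸ hx))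
  have ne_of_mem_right : ∀ y ∈ Y, v ≠ y := fun y hy h => hvU (Or.inr (h ▸ hy))
  let P : Set V := {x ∈ X | ¬ B.Adj v x}
  let Q : Set V := {y ∈ Y | ∃ x ∈ P, x ≠ y ∧ ¬ R.Adj x y}
  have adj_Q : ∀ y ∈ Q, B.Adj v y := by
    rintro y ⟨hy, x, ⟨hx, hvx⟩, hne, hxy⟩
    by_contra hvy
    exact hxy (hv x y (ne_of_mem_left x hx) (ne_of_mem_right y hy) hvx hvy hne)
  have adj_X_Q : ∀ x ∈ X \ P, ∀ y ∈ Q, x ≠ y → B.Adj x y := by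
    rintro z ⟨hz, hzP⟩ y hyQ hne
    have hvy := adj_Q y hyQ
    obtain ⟨hy, x, ⟨hx, hvx⟩, hxy, hxyR⟩ := hyQ
    have hvz : B.Adj v z := by
      by_contra h
      exact hzP ⟨hz, h⟩
    have hxz : x ≠ z := by
      rintro rfl
      exact hvx hvz
    by_contra hzy
    exact hB ⟨v, y, x, z, ne_of_mem_left x hx, hne.symm, hvy,
      ((hBR x y hxy).resolve_right hxyR).symm, hX hx hz hxz, hvz.symm, hvx,
      fun h => hzy h.symm⟩
  have no_common : ∀ x ∈ P, ∀ y ∈ Q, ∀ y' ∈ Q, x ≠ y → ¬ R.Adj x y → x ≠ y' → ¬ R.Adj x y' →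
      y ≠ y' → B.Adj y y' := by
    intro x hx y hy y' hy' hxy hxyR hxy' hxyR' hne
    by_contra h
    exact hB ⟨v, y, x, y', ne_of_mem_left x hx.1, hne, adj_Q y hy,
      ((hBR x y hxy).resolve_right hxyR).symm, (hBR x y' hxy').resolve_right hxyR',
      (adj_Q y' hy').symm, hx.2, h⟩
  have adj_P : ∀ x ∈ P, ∀ x' ∈ P, x ≠ x' → R.Adj x x' := fun x hx x' hx' hne =>
    hv x x' (ne_of_mem_left x hx.1) (ne_of_mem_left x' hx'.1) hx.2 hx'.2 hne
  have ne_P_Q : ∀ x ∈ P, ∀ y ∈ Q, x ≠ y := by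
    rintro x hx y hy rfl
    exact hx.2 (adj_Q x hy)
  have adj_Q_Q : ∀ y ∈ Q, ∀ y' ∈ Q, y ≠ y' → B.Adj y y' := by
    intro y hy y' hy' hne
    obtain ⟨x, hx, hxy, hxyR⟩ := hy.2
    obtain ⟨x', hx', hxy', hxyR'⟩ := hy'.2
    by_cases h₁ : R.Adj x y'
    · by_cases h₂ : R.Adj x' y
      · have hxx' : x ≠ x' := by
          rintro rfl
          exact hxyR h₂
        exact absurd ⟨x, x', y, y', hxy, hxy', adj_P x hx x' hx' hxx', h₂,
          hY hy.1 hy'.1 hne, h₁.symm, hxyR, hxyR'⟩ hR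
      · exact no_common x' hx' y hy y' hy' (ne_P_Q x' hx' y hy) h₂ hxy' hxyR' hne
    · exact no_common x hx y hy y' hy' hxy hxyR (ne_P_Q x hx y' hy') h₁ hne
  have adj_P_Y : ∀ x ∈ P, ∀ y ∈ Y \ Q, x ≠ y → R.Adj x y := by
    rintro x hx y ⟨hy, hyQ⟩ hne
    by_contra h
    exact hyQ ⟨hy, x, hx, hne, h⟩
  refine ⟨insert v (X \ P ∪ Q), P ∪ Y \ Q, ?_, ?_, ?_⟩
  · rw [SimpleGraph.isClique_insert]
    refine ⟨?_, ?_⟩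
    · rintro a (ha | ha) b (hb | hb) hne
      · exact hX ha.1 hb.1 hne
      · exact adj_X_Q a ha b hb hne
      · exact (adj_X_Q b hb a ha hne.symm).symm
      · exact adj_Q_Q a ha b hb hne
    · rintro a (ha | ha) -
      · by_contra h
        exact ha.2 ⟨ha.1, h⟩
      · exact adj_Q a ha
  · rintro a (ha | ha) b (hb | hb) hne
    · exact adj_P a ha b hb hne
    · exact adj_P_Y a ha b hb hne
    · exact (adj_P_Y b hb a ha hne.symm).symm
    · exact hY ha.1 hb.1 hne
  · have hPX : P ⊆ X := fun x hx => hx.1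
    have hQY : Q ⊆ Y := fun y hy => hy.1
    rw [Set.insert_union, ← Set.sdiff_union_of_subset hPX, ← Set.sdiff_union_of_subset hQY]
    congr 1
    ext z
    simp only [Set.mem_union, Set.mem_sdiff]
    tauto

lemma Obedient.symm {V : Type*} {B R : SimpleGraph V} {U : Set V} (h : Obedient B R U) :
    Obedient R B U := by
  obtain ⟨X, Y, hX, hY, rfl⟩ := h
  exact ⟨Y, X, hY, hX, Set.union_comm X Y⟩

/-- In a `C4`-free graph, two distinct non-adjacent vertices do not have two distinct non-adjacent
common neighbours. -/
lemma IsC4Free.not_adj_or_not_adj {V : Type*} {G : SimpleGraph V} (hG : IsC4Free G)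
    {u w p q : V} (huw : u ≠ w) (hpq : p ≠ q) (hup : G.Adj u p) (huq : G.Adj u q)
    (hnuw : ¬ G.Adj u w) (hnpq : ¬ G.Adj p q) : ¬ G.Adj w p ∨ ¬ G.Adj w q := by
  by_contra! h
  exact hG ⟨u, p, w, q, huw, hpq, hup, h.1.symm, h.2, huq.symm, hnuw, hnpq⟩

lemma IsC5Free.false_of_cycle {V : Type*} {G : SimpleGraph V} (hG : IsC5Free G) {a b c d e : V}
    (hab : G.Adj a b) (hbc : G.Adj b c) (hcd : G.Adj c d) (hde : G.Adj d e) (hea : G.Adj e a)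
    (hac : ¬ G.Adj a c) (hbd : ¬ G.Adj b d) (hce : ¬ G.Adj c e) (hda : ¬ G.Adj d a)
    (heb : ¬ G.Adj e b) : False := by
  have nac : a ≠ c := by rintro rfl; exact hda hcd.symm
  have nbd : b ≠ d := by rintro rfl; exact hda hab.symm
  have nce : c ≠ e := by rintro rfl; exact hac hea.symm
  have nda : d ≠ a := by rintro rfl; exact hbd hab.symm
  have neb : e ≠ b := by rintro rfl; exact hce hbc.symm
  refine hG ⟨![a, b, c, d, e], ?_, ?_, ?_⟩
  · have := hab.ne
    have := hbc.ne
    have := hcd.ne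
    have := hde.ne
    have := hea.ne
    intro i j hij
    fin_cases i <;> fin_cases j <;> simp_all
  · intro i
    fin_cases i <;> assumption
  · intro i
    fin_cases i <;> assumption

/-- Every vertex satisfies the hypothesis of `Obedient.insert_of_nonadj` for `(B, R)` or for
`(R, B)`. -/
lemma nonadj_pairwise_adj_or {V : Type*} {B R : SimpleGraph V}
    (hB4 : IsC4Free B) (hR4 : IsC4Free R) (hR5 : IsC5Free R)
    (hBR : ∀ x y, x ≠ y → B.Adj x y ∨ R.Adj x y) (v : V) :
    (∀ p q, v ≠ p → v ≠ q → ¬ B.Adj v p → ¬ B.Adj v q → p ≠ q → R.Adj p q) ∨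
      ∀ s t, v ≠ s → v ≠ t → ¬ R.Adj v s → ¬ R.Adj v t → s ≠ t → B.Adj s t := by
  by_contra! h
  obtain ⟨⟨p, q, hvp, hvq, nvp, nvq, hpq, npq⟩, s, t, hvs, hvt, nvs, nvt, hst, nst⟩ := h
  have rvp := (hBR v p hvp).resolve_left nvp
  have rvq := (hBR v q hvq).resolve_left nvq
  have rst := (hBR s t hst).resolve_left nst
  have bvs := (hBR v s hvs).resolve_right nvs
  have bvt := (hBR v t hvt).resolve_right nvt
  have hs := hR4.not_adj_or_not_adj hvs hpq rvp rvq nvs npq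
  have ht := hR4.not_adj_or_not_adj hvt hpq rvp rvq nvt npq
  have hp := hB4.not_adj_or_not_adj hvp hst bvs bvt nvp nst
  have hq := hB4.not_adj_or_not_adj hvq hst bvs bvt nvq nst
  have hps : p ≠ s := by rintro rfl; exact nvs rvp
  have hpt : p ≠ t := by rintro rfl; exact nvt rvp
  have hqs : q ≠ s := by rintro rfl; exact nvs rvq
  have hqt : q ≠ t := by rintro rfl; exact nvt rvq
  have ops := hBR p s hps
  have opt := hBR p t hpt
  have oqs := hBR q s hqs
  have oqt := hBR q t hqt
  rw [R.adj_comm s p, R.adj_comm s q] at hs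
  rw [R.adj_comm t p, R.adj_comm t q] at ht
  have key : (R.Adj p t ∧ R.Adj q s ∧ ¬ R.Adj p s ∧ ¬ R.Adj q t) ∨
      (R.Adj p s ∧ R.Adj q t ∧ ¬ R.Adj p t ∧ ¬ R.Adj q s) := by tauto
  rcases key with ⟨h₁, h₂, h₃, h₄⟩ | ⟨h₁, h₂, h₃, h₄⟩
  · exact hR5.false_of_cycle rvp h₁ rst.symm h₂.symm rvq.symm nvt h₃
      (fun h => h₄ h.symm) (fun h => nvs h.symm) (fun h => npq h.symm)
  · exact hR5.false_of_cycle rvp h₁ rst h₂.symm rvq.symm nvs h₃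
      (fun h => h₄ h.symm) (fun h => nvt h.symm) (fun h => npq h.symm)

theorem stmt_2 {V : Type*} [Fintype V] (B R : SimpleGraph V)
    (hB4 : IsC4Free B) (hR4 : IsC4Free R) (hR5 : IsC5Free R)
    (hcomplete : B ⊔ R = ⊤) :
    Obedient B R Set.univ := by
  have hBR : ∀ x y, x ≠ y → B.Adj x y ∨ R.Adj x y := by
    intro x y hne
    rw [← SimpleGraph.sup_adj, hcomplete]
    exact hne
  suffices ∀ U : Set V, Obedient B R U from this Set.univ
  intro U
  induction U, U.toFinite using Set.Finite.induction_on with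
  | empty => exact ⟨∅, ∅, by simp, by simp, by simp⟩
  | @insert v U _ _ ih =>
    rcases nonadj_pairwise_adj_or hB4 hR4 hR5 hBR v with h | h
    · exact ih.insert_of_nonadj hB4 hR4 hBR h
    · exact (ih.symm.insert_of_nonadj hR4 hB4 (fun x y hne => (hBR x y hne).symm) h).symm
end

section
/- If B and R are two C4-free simple graphs on the same finite vertex set V, then ω(G(B,R)) ≤ ω(B) + ω(R) + ω(H(B,R)), where ω denotes the clique number. -/
/-- Any two edges of `P` either meet or are joined by an edge of `P`
(the complement of such a graph is `C4`-free, and conversely). -/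
def IsTwoEdgeFree {V : Type*} (P : SimpleGraph V) : Prop :=
  ∀ a b c d : V, P.Adj a b → P.Adj c d → P.Adj a c ∨ P.Adj a d ∨ P.Adj b c ∨ P.Adj b d

/-- `v` is the apex of a triangle with two edges of `P` at `v` and third edge in `Q`. -/
def IsApex {V : Type*} (P Q : SimpleGraph V) (v : V) : Prop :=
  ∃ b c : V, P.Adj v b ∧ P.Adj v c ∧ Q.Adj b c

/-- The graph of pairs of distinct vertices of `K` that are not adjacent in `G`. -/
def nonAdjOn {V : Type*} (G : SimpleGraph V) (K : Set V) : SimpleGraph V where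
  Adj a b := a ∈ K ∧ b ∈ K ∧ a ≠ b ∧ ¬ G.Adj a b
  symm := ⟨fun _ _ h => ⟨h.2.1, h.1, h.2.2.1.symm, fun h' => h.2.2.2 h'.symm⟩⟩
  loopless := ⟨fun _ h => h.2.2.1 rfl⟩

/-- `V` is the union of an independent set of `P`, an independent set of `Q` and a set that is
independent in both. -/
def HasIndepCover {V : Type*} (P Q : SimpleGraph V) : Prop :=
  ∃ X Y Z : V → Prop, (∀ v, X v ∨ Y v ∨ Z v) ∧
    (∀ a b, X a → X b → ¬ P.Adj a b) ∧ (∀ a b, Y a → Y b → ¬ Q.Adj a b) ∧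
    (∀ a b, Z a → Z b → ¬ P.Adj a b ∧ ¬ Q.Adj a b)

section

variable {V : Type*} {P Q : SimpleGraph V}

theorem IsC4Free.isTwoEdgeFree_nonAdjOn {G : SimpleGraph V} (h : IsC4Free G) (K : Set V) :
    IsTwoEdgeFree (nonAdjOn G K) := by
  intro a b c d hab hcd
  by_contra! hn
  obtain ⟨h1, h2, h3, h4⟩ := hn
  have key : ∀ x ∈ K, ∀ y ∈ K, x ≠ y → ¬ (nonAdjOn G K).Adj x y → G.Adj x y := by
    intro x hx y hy hxy hn
    by_contra hG
    exact hn ⟨hx, hy, hxy, hG⟩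
  have nac : a ≠ c := by rintro rfl; exact h2 hcd
  have nad : a ≠ d := by rintro rfl; exact h1 hcd.symm
  have nbc : b ≠ c := by rintro rfl; exact h4 hcd
  have nbd : b ≠ d := by rintro rfl; exact h3 hcd.symm
  obtain ⟨ka, kb, ab, gab⟩ := hab
  obtain ⟨kc, kd, cd, gcd⟩ := hcd
  exact h ⟨a, c, b, d, ab, cd, key _ ka _ kc nac h1, (key _ kb _ kc nbc h3).symm,
    key _ kb _ kd nbd h4, (key _ ka _ kd nad h2).symm, gab, gcd⟩

theorem IsApex.swap_of_adj (hQ : IsTwoEdgeFree Q) (hd : ∀ a b, P.Adj a b → ¬ Q.Adj a b)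
    {u w : V} (hu : IsApex P Q u) (huw : Q.Adj u w) : IsApex Q P w := by
  obtain ⟨b, c, hb, hc, hbc⟩ := hu
  rcases hQ u w b c huw hbc with h | h | h | h
  · exact absurd h (hd _ _ hb)
  · exact absurd h (hd _ _ hc)
  · exact ⟨u, b, huw.symm, h, hb⟩
  · exact ⟨u, c, huw.symm, h, hc⟩

/-- Two complementary pentagons `P`, `Q` force the cover by independent sets. -/
theorem hasIndepCover_of_pentagon (hP : IsTwoEdgeFree P) (hQ : IsTwoEdgeFree Q)
    (hd : ∀ a b, P.Adj a b → ¬ Q.Adj a b) {c0 c1 c2 c3 c4 : V}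
    (p0 : P.Adj c0 c1) (p1 : P.Adj c1 c2) (p2 : P.Adj c2 c3) (p3 : P.Adj c3 c4)
    (p4 : P.Adj c4 c0) (q0 : Q.Adj c0 c2) (q1 : Q.Adj c1 c3) (q2 : Q.Adj c2 c4)
    (q3 : Q.Adj c3 c0) (q4 : Q.Adj c4 c1) : HasIndepCover P Q := by
  let A : V → Prop := fun w => ¬ P.Adj w c0 ∧ ¬ P.Adj w c1 ∧ ¬ P.Adj w c2 ∧ ¬ P.Adj w c3 ∧
    ¬ P.Adj w c4
  let D : V → Prop := fun w => ¬ Q.Adj w c0 ∧ ¬ Q.Adj w c1 ∧ ¬ Q.Adj w c2 ∧ ¬ Q.Adj w c3 ∧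
    ¬ Q.Adj w c4
  let T : V → V → V → V → V → V → Prop := fun a b c d e w =>
    P.Adj w b ∧ P.Adj w e ∧ Q.Adj w c ∧ Q.Adj w d ∧ ¬ P.Adj w a ∧ ¬ Q.Adj w a
  have sep : ∀ {G : SimpleGraph V}, IsTwoEdgeFree G → ∀ {x y : V}, G.Adj x y → ∀ u w : V,
      ¬ G.Adj u x → ¬ G.Adj u y → ¬ G.Adj w x → ¬ G.Adj w y → ¬ G.Adj u w := by
    intro G hG x y hxy u w h1 h2 h3 h4 h
    rcases hG u w x y h hxy with h | h | h | h <;> contradiction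
  have rule : ∀ {G : SimpleGraph V}, IsTwoEdgeFree G → ∀ {x y z : V}, G.Adj y z →
      ¬ G.Adj x y → ¬ G.Adj x z → ∀ w : V, G.Adj w x → G.Adj w y ∨ G.Adj w z := by
    intro G hG x y z hyz h1 h2 w h
    rcases hG w x y z h hyz with h | h | h | h <;> tauto
  have hd' : ∀ a b, Q.Adj a b → ¬ P.Adj a b := fun a b h h' => hd a b h' h
  refine ⟨fun w => A w ∨ T c0 c1 c2 c3 c4 w ∨ T c2 c3 c4 c0 c1 w,
    fun w => D w ∨ T c3 c4 c0 c1 c2 w ∨ T c4 c0 c1 c2 c3 w, T c1 c2 c3 c4 c0, ?_, ?_, ?_, ?_⟩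
  · intro w
    have a0 := rule hP p2 (hd' _ _ q0) (hd' _ _ q3.symm) w
    have a1 := rule hP p3 (hd' _ _ q1) (hd' _ _ q4.symm) w
    have a2 := rule hP p4 (hd' _ _ q2) (hd' _ _ q0.symm) w
    have a3 := rule hP p0 (hd' _ _ q3) (hd' _ _ q1.symm) w
    have a4 := rule hP p1 (hd' _ _ q4) (hd' _ _ q2.symm) w
    have b0 := rule hQ q4 (hd _ _ p4.symm) (hd _ _ p0) w
    have b1 := rule hQ q0 (hd _ _ p0.symm) (hd _ _ p1) w
    have b2 := rule hQ q1 (hd _ _ p1.symm) (hd _ _ p2) w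
    have b3 := rule hQ q2 (hd _ _ p2.symm) (hd _ _ p3) w
    have b4 := rule hQ q3 (hd _ _ p3.symm) (hd _ _ p4) w
    have e0 := hd w c0
    have e1 := hd w c1
    have e2 := hd w c2
    have e3 := hd w c3
    have e4 := hd w c4
    simp only [A, D, T]
    clear sep rule hd hd' hP hQ p0 p1 p2 p3 p4 q0 q1 q2 q3 q4
    clear A D T
    generalize P.Adj w c0 = x0, P.Adj w c1 = x1, P.Adj w c2 = x2, P.Adj w c3 = x3,
      P.Adj w c4 = x4, Q.Adj w c0 = y0, Q.Adj w c1 = y1, Q.Adj w c2 = y2, Q.Adj w c3 = y3,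
      Q.Adj w c4 = y4 at *
    by_cases x0 <;> by_cases x1 <;> by_cases x2 <;> by_cases x3 <;> by_cases x4 <;> simp_all <;>
      grind
  · have cross : ∀ u w, T c0 c1 c2 c3 c4 u → T c2 c3 c4 c0 c1 w → Q.Adj u w := by
      rintro u w ⟨-, u4, -, u3, -, -⟩ ⟨w3, -, w4, -, -, -⟩
      rcases hQ u c3 w c4 u3 w4 with h | h | h | h
      · exact h
      · exact absurd h (hd _ _ u4)
      · exact absurd h.symm (hd _ _ w3)
      · exact absurd h (hd _ _ p3)
    have n0 : ∀ u, A u ∨ T c0 c1 c2 c3 c4 u → ¬ P.Adj u c2 ∧ ¬ P.Adj u c3 := by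
      rintro u (h | h)
      · exact ⟨h.2.2.1, h.2.2.2.1⟩
      · exact ⟨hd' _ _ h.2.2.1, hd' _ _ h.2.2.2.1⟩
    have n2 : ∀ u, A u ∨ T c2 c3 c4 c0 c1 u → ¬ P.Adj u c4 ∧ ¬ P.Adj u c0 := by
      rintro u (h | h)
      · exact ⟨h.2.2.2.2, h.1⟩
      · exact ⟨hd' _ _ h.2.2.1, hd' _ _ h.2.2.2.1⟩
    have s0 : ∀ u w, A u ∨ T c0 c1 c2 c3 c4 u → A w ∨ T c0 c1 c2 c3 c4 w → ¬ P.Adj u w :=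
      fun u w hu hw => sep hP p2 u w (n0 u hu).1 (n0 u hu).2 (n0 w hw).1 (n0 w hw).2
    have s2 : ∀ u w, A u ∨ T c2 c3 c4 c0 c1 u → A w ∨ T c2 c3 c4 c0 c1 w → ¬ P.Adj u w :=
      fun u w hu hw => sep hP p4 u w (n2 u hu).1 (n2 u hu).2 (n2 w hw).1 (n2 w hw).2
    rintro u w (hu | hu | hu) (hw | hw | hw)
    · exact s0 u w (.inl hu) (.inl hw)
    · exact s0 u w (.inl hu) (.inr hw)
    · exact s2 u w (.inl hu) (.inr hw)
    · exact s0 u w (.inr hu) (.inl hw)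
    · exact s0 u w (.inr hu) (.inr hw)
    · exact hd' _ _ (cross u w hu hw)
    · exact s2 u w (.inr hu) (.inl hw)
    · exact fun h => hd' _ _ (cross w u hw hu) h.symm
    · exact s2 u w (.inr hu) (.inr hw)
  · have cross : ∀ u w, T c3 c4 c0 c1 c2 u → T c4 c0 c1 c2 c3 w → P.Adj u w := by
      rintro u w ⟨-, u2, u0, -, -, -⟩ ⟨w0, -, -, w2, -, -⟩
      rcases hP u c2 w c0 u2 w0 with h | h | h | h
      · exact h
      · exact absurd h (hd' _ _ u0)
      · exact absurd h.symm (hd' _ _ w2)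
      · exact absurd h.symm (hd' _ _ q0)
    have n3 : ∀ u, D u ∨ T c3 c4 c0 c1 c2 u → ¬ Q.Adj u c2 ∧ ¬ Q.Adj u c4 := by
      rintro u (h | h)
      · exact ⟨h.2.2.1, h.2.2.2.2⟩
      · exact ⟨hd _ _ h.2.1, hd _ _ h.1⟩
    have n4 : ∀ u, D u ∨ T c4 c0 c1 c2 c3 u → ¬ Q.Adj u c3 ∧ ¬ Q.Adj u c0 := by
      rintro u (h | h)
      · exact ⟨h.2.2.2.1, h.1⟩
      · exact ⟨hd _ _ h.2.1, hd _ _ h.1⟩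
    have s3 : ∀ u w, D u ∨ T c3 c4 c0 c1 c2 u → D w ∨ T c3 c4 c0 c1 c2 w → ¬ Q.Adj u w :=
      fun u w hu hw => sep hQ q2 u w (n3 u hu).1 (n3 u hu).2 (n3 w hw).1 (n3 w hw).2
    have s4 : ∀ u w, D u ∨ T c4 c0 c1 c2 c3 u → D w ∨ T c4 c0 c1 c2 c3 w → ¬ Q.Adj u w :=
      fun u w hu hw => sep hQ q3 u w (n4 u hu).1 (n4 u hu).2 (n4 w hw).1 (n4 w hw).2
    rintro u w (hu | hu | hu) (hw | hw | hw)
    · exact s3 u w (.inl hu) (.inl hw)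
    · exact s3 u w (.inl hu) (.inr hw)
    · exact s4 u w (.inl hu) (.inr hw)
    · exact s3 u w (.inr hu) (.inl hw)
    · exact s3 u w (.inr hu) (.inr hw)
    · exact hd _ _ (cross u w hu hw)
    · exact s4 u w (.inr hu) (.inl hw)
    · exact fun h => hd _ _ (cross w u hw hu) h.symm
    · exact s4 u w (.inr hu) (.inr hw)
  · rintro u w ⟨u2, u0, u3, u4, -, -⟩ ⟨w2, w0, w3, w4, -, -⟩
    exact ⟨sep hP p3 u w (hd' _ _ u3) (hd' _ _ u4) (hd' _ _ w3) (hd' _ _ w4),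
      sep hQ q0 u w (hd _ _ u0) (hd _ _ u2) (hd _ _ w0) (hd _ _ w2)⟩

theorem hasIndepCover_of_isApex (hP : IsTwoEdgeFree P) (hQ : IsTwoEdgeFree Q)
    (hd : ∀ a b, P.Adj a b → ¬ Q.Adj a b) {v : V} (h1 : IsApex P Q v) (h2 : IsApex Q P v) :
    HasIndepCover P Q := by
  obtain ⟨b, c, vb, vc, bc⟩ := h1
  obtain ⟨d, e, vd, ve, de⟩ := h2
  have hd' : ∀ a b, Q.Adj a b → ¬ P.Adj a b := fun a b h h' => hd a b h' h
  have b1 : P.Adj b d ∨ P.Adj b e := by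
    rcases hP v b d e vb de with h | h | h | h
    · exact absurd h (hd' _ _ vd)
    · exact absurd h (hd' _ _ ve)
    · exact .inl h
    · exact .inr h
  have c1 : P.Adj c d ∨ P.Adj c e := by
    rcases hP v c d e vc de with h | h | h | h
    · exact absurd h (hd' _ _ vd)
    · exact absurd h (hd' _ _ ve)
    · exact .inl h
    · exact .inr h
  have d1 : Q.Adj d b ∨ Q.Adj d c := by
    rcases hQ v d b c vd bc with h | h | h | h
    · exact absurd h (hd _ _ vb)
    · exact absurd h (hd _ _ vc)
    · exact .inl h
    · exact .inr h
  have e1 : Q.Adj e b ∨ Q.Adj e c := by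
    rcases hQ v e b c ve bc with h | h | h | h
    · exact absurd h (hd _ _ vb)
    · exact absurd h (hd _ _ vc)
    · exact .inl h
    · exact .inr h
  rcases b1 with bd | be
  · have dc := d1.resolve_left fun h => hd _ _ bd h.symm
    have ce := c1.resolve_left fun h => hd _ _ h dc.symm
    have eb := e1.resolve_right fun h => hd _ _ ce h.symm
    exact hasIndepCover_of_pentagon hP hQ hd vb bd de ce.symm vc.symm vd eb.symm dc ve.symm
      bc.symm
  · have ec := e1.resolve_left fun h => hd _ _ be h.symm
    have cd := c1.resolve_right fun h => hd _ _ h ec.symm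
    have db := d1.resolve_right fun h => hd _ _ cd h.symm
    exact hasIndepCover_of_pentagon hP hQ hd vb be de.symm cd.symm vc.symm ve db.symm ec vd.symm
      bc.symm

/-- The vertices that are apexes of no mixed triangle admit the required two-colouring. -/
theorem exists_indep_partition_of_not_isApex (hP : IsTwoEdgeFree P)
    (hd : ∀ a b, P.Adj a b → ¬ Q.Adj a b) (S : Finset V)
    (hS : ∀ v ∈ S, ¬ IsApex P Q v) :
    ∃ X : V → Prop, ∀ a ∈ S, ∀ b ∈ S,
      (P.Adj a b → ¬ (X a ∧ X b)) ∧ (Q.Adj a b → X a ∨ X b) := by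
  classical
  induction S using Finset.induction with
  | empty => exact ⟨fun _ => True, by simp⟩
  | insert v S _ ih =>
    obtain ⟨X, hX⟩ := ih fun w hw => hS w (Finset.mem_insert_of_mem hw)
    have hv := hS v (Finset.mem_insert_self v S)
    let X' : V → Prop := fun c => c = v ∨ ∃ b, P.Adj v b ∧ Q.Adj b c
    have closeP : ∀ c d, d ∈ insert v S → X' c → P.Adj c d → P.Adj v d := by
      rintro c d hdS (rfl | ⟨b, vb, bc⟩) cd
      · exact cd
      · rcases hP v b c d vb cd with h | h | h | h
        · exact absurd ⟨b, c, vb, h, bc⟩ hv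
        · exact h
        · exact absurd bc (hd _ _ h)
        · exact absurd ⟨b, c, h.symm, cd.symm, bc⟩ (hS d hdS)
    have disj : ∀ c, X' c → ¬ P.Adj v c := by
      rintro c (rfl | ⟨b, vb, bc⟩) h
      · exact h.ne rfl
      · exact hv ⟨b, c, vb, h, bc⟩
    refine ⟨fun w => X' w ∨ (X w ∧ ¬ P.Adj v w), ?_⟩
    intro a ha b hb
    constructor
    · rintro hab ⟨h1, h2⟩
      rcases h1 with h1 | h1
      · have := closeP a b hb h1 hab
        rcases h2 with h2 | h2
        · exact disj b h2 this
        · exact h2.2 this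
      · rcases h2 with h2 | h2
        · exact h1.2 (closeP b a ha h2 hab.symm)
        · have ha' : a ∈ S := by
            rcases Finset.mem_insert.1 ha with rfl | h
            · exact absurd hab h2.2
            · exact h
          have hb' : b ∈ S := by
            rcases Finset.mem_insert.1 hb with rfl | h
            · exact absurd hab.symm h1.2
            · exact h
          exact (hX a ha' b hb').1 hab ⟨h1.1, h2.1⟩
    · intro hab
      by_cases hva : P.Adj v a
      · exact .inr (.inl (.inr ⟨a, hva, hab⟩))
      by_cases hvb : P.Adj v b
      · exact .inl (.inl (.inr ⟨b, hvb, hab.symm⟩))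
      rcases Finset.mem_insert.1 ha with rfl | ha'
      · exact .inl (.inl (.inl rfl))
      rcases Finset.mem_insert.1 hb with rfl | hb'
      · exact .inr (.inl (.inl rfl))
      rcases (hX a ha' b hb').2 hab with h | h
      · exact .inl (.inr ⟨h, hva⟩)
      · exact .inr (.inr ⟨h, hvb⟩)

theorem hasIndepCover [Fintype V] (hP : IsTwoEdgeFree P) (hQ : IsTwoEdgeFree Q)
    (hd : ∀ a b, P.Adj a b → ¬ Q.Adj a b) : HasIndepCover P Q := by
  classical
  by_cases hex : ∃ v, IsApex P Q v ∧ IsApex Q P v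
  · obtain ⟨v, h1, h2⟩ := hex
    exact hasIndepCover_of_isApex hP hQ hd h1 h2
  push Not at hex
  have hd' : ∀ a b, Q.Adj a b → ¬ P.Adj a b := fun a b h h' => hd a b h' h
  obtain ⟨X, hX⟩ := exists_indep_partition_of_not_isApex hP hd
    (Finset.univ.filter fun v => ¬ IsApex P Q v) (by simp)
  simp only [Finset.mem_filter, Finset.mem_univ, true_and] at hX
  have hPQ : ∀ u w, IsApex P Q u → Q.Adj u w → IsApex Q P w :=
    fun u w hu h => hu.swap_of_adj hQ hd h
  have hQP : ∀ u w, IsApex Q P u → P.Adj u w → IsApex P Q w :=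
    fun u w hu h => hu.swap_of_adj hP hd' h
  refine ⟨fun v => IsApex Q P v ∨ (¬ IsApex P Q v ∧ X v),
    fun v => ¬ IsApex Q P v ∧ (IsApex P Q v ∨ ¬ X v), fun _ => False, ?_, ?_, ?_, by simp⟩
  · intro v
    tauto
  · rintro a b (ha | ⟨ha, xa⟩) (hb | ⟨hb, xb⟩) h
    · exact hex _ (hQP a b ha h) hb
    · exact hb (hQP a b ha h)
    · exact ha (hQP b a hb h.symm)
    · exact (hX a ha b hb).1 h ⟨xa, xb⟩
  · rintro a b ⟨ha, ha'⟩ ⟨hb, hb'⟩ h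
    by_cases pa : IsApex P Q a
    · exact hb (hPQ a b pa h)
    by_cases pb : IsApex P Q b
    · exact ha (hPQ b a pb h.symm)
    rcases (hX a pa b pb).2 h with h' | h'
    · exact ha'.resolve_left pa h'
    · exact hb'.resolve_left pb h'

end

theorem stmt_9 {V : Type*} [Fintype V] (B R : SimpleGraph V)
    (hB4 : IsC4Free B) (hR4 : IsC4Free R) :
    (B ⊔ R).cliqueNum ≤ B.cliqueNum + R.cliqueNum + (B ⊓ R).cliqueNum := by
  classical
  obtain ⟨K, hK⟩ := (B ⊔ R).exists_isNClique_cliqueNum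
  have hd : ∀ a b, (nonAdjOn B K).Adj a b → ¬ (nonAdjOn R K).Adj a b := by
    rintro a b ⟨ka, kb, ne, nB⟩ ⟨-, -, -, nR⟩
    rcases hK.isClique ka kb ne with h | h
    · exact nB h
    · exact nR h
  obtain ⟨X, Y, Z, hcov, hX, hY, hZ⟩ :=
    hasIndepCover (hB4.isTwoEdgeFree_nonAdjOn K) (hR4.isTwoEdgeFree_nonAdjOn K) hd
  have clique : ∀ (G : SimpleGraph V) (W : V → Prop),
      (∀ a b, W a → W b → ¬ (nonAdjOn G K).Adj a b) → G.IsClique (K.filter W : Finset V) := by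
    intro G W hW a ha b hb hab
    rw [Finset.mem_coe, Finset.mem_filter] at ha hb
    by_contra h
    exact hW a b ha.2 hb.2 ⟨ha.1, hb.1, hab, h⟩
  have cB := (clique B X hX).card_le_cliqueNum
  have cR := (clique R Y hY).card_le_cliqueNum
  have cH : (K.filter Z).card ≤ (B ⊓ R).cliqueNum := by
    apply SimpleGraph.IsClique.card_le_cliqueNum
    intro a ha b hb hab
    exact ⟨clique B Z (fun a b ha hb => (hZ a b ha hb).1) ha hb hab,
      clique R Z (fun a b ha hb => (hZ a b ha hb).2) ha hb hab⟩
  have hsub : K ⊆ K.filter X ∪ K.filter Y ∪ K.filter Z := by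
    intro v hv
    have := hcov v
    simp only [Finset.mem_union, Finset.mem_filter]
    tauto
  have h1 := Finset.card_le_card hsub
  have h2 := Finset.card_union_le (K.filter X ∪ K.filter Y) (K.filter Z)
  have h3 := Finset.card_union_le (K.filter X) (K.filter Y)
  have h4 := hK.card_eq
  omega
end

section
/- Let B and R be C4-free simple graphs on the same finite vertex set V such that G(B,R) is the complete graph on V and G(B,R) does not contain a double C5. Let v1,...,v5 be distinct vertices such that v1v2, v2v3, v3v4 are edges of R but not of B, the pairs v1v3, v3v5, v5v2, v2v4, v4v1 are edges of B but not of R, and v4v5, v5v1 are edges of B. Then every vertex u ∈ V \ {v1,...,v5} is either R-adjacent to both v2 and v3, or B-adjacent to all of v1, v4, v5. -/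
/-- `S` induces a cycle of length five in `G`. -/
def IsInducedC5On {V : Type*} (G : SimpleGraph V) (S : Set V) : Prop :=
  ∃ v : Fin 5 → V, Function.Injective v ∧ Set.range v = S ∧
    (∀ i, G.Adj (v i) (v (i + 1))) ∧ (∀ i, ¬ G.Adj (v i) (v (i + 2)))

/-- `G(B,R)` contains a double `C5`: a set of five vertices inducing a
cycle of length five in both `B` and `R`. -/
def HasDoubleC5 {V : Type*} (B R : SimpleGraph V) : Prop :=
  ∃ S : Set V, IsInducedC5On B S ∧ IsInducedC5On R S

/-- Five vertices whose cyclic neighbours are adjacent and whose chords are missing form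
an induced cycle of length five. -/
lemma isInducedC5On_of_adj {V : Type*} {G : SimpleGraph V} {a b c d e : V}
    (hab : G.Adj a b) (hbc : G.Adj b c) (hcd : G.Adj c d) (hde : G.Adj d e) (hea : G.Adj e a)
    (hac : ¬ G.Adj a c) (hbd : ¬ G.Adj b d) (hce : ¬ G.Adj c e) (hda : ¬ G.Adj d a)
    (heb : ¬ G.Adj e b) : IsInducedC5On G (Set.range ![a, b, c, d, e]) := by
  have hinj : Function.Injective ![a, b, c, d, e] := by
    have ac : a ≠ c := by rintro rfl; exact hda hcd.symm
    have bd : b ≠ d := by rintro rfl; exact heb hde.symm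
    have ce : c ≠ e := by rintro rfl; exact hac hea.symm
    have da : d ≠ a := by rintro rfl; exact hbd hab.symm
    have eb : e ≠ b := by rintro rfl; exact hce hbc.symm
    intro i j hij
    fin_cases i <;> fin_cases j <;>
      simp_all [hab.ne, hbc.ne, hcd.ne, hde.ne, hea.ne, hab.ne', hbc.ne', hcd.ne', hde.ne',
        hea.ne', ac.symm, bd.symm, ce.symm, da.symm, eb.symm]
  refine ⟨![a, b, c, d, e], hinj, rfl, ?_, ?_⟩ <;> intro i <;> fin_cases i <;> assumption

lemma IsC4Free.not_isInducedC4 {V : Type*} {G : SimpleGraph V} (hG : IsC4Free G) (a b c d : V)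
    (hac : a ≠ c) (hbd : b ≠ d) :
    ¬ (G.Adj a b ∧ G.Adj b c ∧ G.Adj c d ∧ G.Adj d a ∧ ¬ G.Adj a c ∧ ¬ G.Adj b d) :=
  fun h => hG ⟨a, b, c, d, hac, hbd, h⟩

theorem stmt_11 {V : Type*} [Fintype V] (B R : SimpleGraph V)
    (hB4 : IsC4Free B) (hR4 : IsC4Free R)
    (hcomplete : B ⊔ R = ⊤)
    (hnoDouble : ¬ HasDoubleC5 B R)
    (v₁ v₂ v₃ v₄ v₅ : V)
    (hdist : [v₁, v₂, v₃, v₄, v₅].Pairwise (· ≠ ·))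
    (h12 : R.Adj v₁ v₂ ∧ ¬ B.Adj v₁ v₂)
    (h23 : R.Adj v₂ v₃ ∧ ¬ B.Adj v₂ v₃)
    (h34 : R.Adj v₃ v₄ ∧ ¬ B.Adj v₃ v₄)
    (h13 : B.Adj v₁ v₃ ∧ ¬ R.Adj v₁ v₃)
    (h35 : B.Adj v₃ v₅ ∧ ¬ R.Adj v₃ v₅)
    (h52 : B.Adj v₅ v₂ ∧ ¬ R.Adj v₅ v₂)
    (h24 : B.Adj v₂ v₄ ∧ ¬ R.Adj v₂ v₄)
    (h41 : B.Adj v₄ v₁ ∧ ¬ R.Adj v₄ v₁)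
    (h45 : B.Adj v₄ v₅) (h51 : B.Adj v₅ v₁) :
    ∀ u : V, u ∉ ({v₁, v₂, v₃, v₄, v₅} : Set V) →
      (R.Adj u v₂ ∧ R.Adj u v₃) ∨ (B.Adj u v₁ ∧ B.Adj u v₄ ∧ B.Adj u v₅) := by
  intro u hu
  simp only [Set.mem_insert_iff, Set.mem_singleton_iff, not_or] at hu
  obtain ⟨hu₁, hu₂, hu₃, hu₄, hu₅⟩ := hu
  simp only [List.pairwise_cons, List.mem_cons, List.not_mem_nil, or_false, forall_eq_or_imp,
    forall_eq] at hdist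
  obtain ⟨⟨n12, n13, n14, n15⟩, ⟨n23, n24, n25⟩, ⟨n34, n35⟩, n45, -⟩ := hdist
  have cover : ∀ x, u ≠ x → B.Adj u x ∨ R.Adj u x := fun x hx => by
    rw [← SimpleGraph.sup_adj, hcomplete]
    exact hx
  have c₁ := cover v₁ hu₁
  have c₂ := cover v₂ hu₂
  have c₃ := cover v₃ hu₃
  have c₄ := cover v₄ hu₄
  have c₅ := cover v₅ hu₅
  have noDouble : ¬ (¬ B.Adj u v₁ ∧ ¬ R.Adj u v₂ ∧ ¬ R.Adj u v₃ ∧ ¬ B.Adj u v₄) := by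
    rintro ⟨b₁, r₂, r₃, b₄⟩
    have r₁ := c₁.resolve_left b₁
    have b₂ := c₂.resolve_right r₂
    have b₃ := c₃.resolve_right r₃
    have r₄ := c₄.resolve_left b₄
    have hrange : Set.range ![u, v₂, v₄, v₁, v₃] = Set.range ![u, v₁, v₂, v₃, v₄] := by
      ext x
      simp only [Matrix.range_cons, Matrix.range_empty, Set.mem_union, Set.mem_singleton_iff,
        Set.mem_empty_iff_false]
      tauto
    refine hnoDouble ⟨Set.range ![u, v₁, v₂, v₃, v₄], hrange ▸ ?_, ?_⟩
    · exact isInducedC5On_of_adj b₂ h24.1 h41.1 h13.1 b₃.symm b₄ (fun h => h12.2 h.symm)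
        (fun h => h34.2 h.symm) (fun h => b₁ h.symm) (fun h => h23.2 h.symm)
    · exact isInducedC5On_of_adj r₁ h12.1 h23.1 h34.1 r₄.symm r₂ h13.2 h24.2
        (fun h => r₃ h.symm) h41.2
  have k₁ := hB4.not_isInducedC4 u v₁ v₄ v₂ hu₄ n12
  have k₂ := hB4.not_isInducedC4 u v₁ v₅ v₂ hu₅ n12
  have k₃ := hB4.not_isInducedC4 u v₃ v₁ v₄ hu₁ n34
  have k₄ := hB4.not_isInducedC4 u v₃ v₅ v₄ hu₅ n34
  have k₅ := hR4.not_isInducedC4 u v₁ v₂ v₃ hu₂ n13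
  have k₆ := hR4.not_isInducedC4 u v₂ v₃ v₄ hu₃ n24
  grind [SimpleGraph.adj_comm]
end

section
/- Let B and R be C4-free simple graphs on the same finite vertex set V such that G(B,R) is the complete graph on V and G(B,R) does not contain a double C5. Let v1,...,v5 be distinct vertices such that v1v2, v2v3, v3v4 are edges of R but not of B, the pairs v1v3, v3v5, v5v2, v2v4, v4v1 are edges of B but not of R, and v4v5, v5v1 are edges of B. Let A be the set of vertices u ∈ V \ {v1,...,v5} that are not R-adjacent to both v2 and v3. Then A ∪ {v1, v4, v5} is a clique of B. -/
/-- In a `C4`-free graph, a four-cycle with one missing diagonal has the other diagonal. -/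
theorem IsC4Free.adj_of_cycle {V : Type*} {G : SimpleGraph V} (hG : IsC4Free G) {a b c d : V}
    (hac : a ≠ c) (hbd : b ≠ d) (hab : G.Adj a b) (hbc : G.Adj b c) (hcd : G.Adj c d)
    (hda : G.Adj d a) (hnac : ¬ G.Adj a c) : G.Adj b d := by
  by_contra hnbd
  exact hG ⟨a, b, c, d, hac, hbd, hab, hbc, hcd, hda, hnac, hnbd⟩

/-- If the five-cycle `a b c d e` is induced in `R` and the complementary five-cycle
`a c e b d` is induced in `B`, then `G(B,R)` contains a double `C5`. -/
theorem hasDoubleC5_of_adj {V : Type*} {B R : SimpleGraph V} {a b c d e : V}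
    (hab : R.Adj a b ∧ ¬ B.Adj a b) (hbc : R.Adj b c ∧ ¬ B.Adj b c)
    (hcd : R.Adj c d ∧ ¬ B.Adj c d) (hde : R.Adj d e ∧ ¬ B.Adj d e)
    (hea : R.Adj e a ∧ ¬ B.Adj e a) (hac : B.Adj a c ∧ ¬ R.Adj a c)
    (hce : B.Adj c e ∧ ¬ R.Adj c e) (heb : B.Adj e b ∧ ¬ R.Adj e b)
    (hbd : B.Adj b d ∧ ¬ R.Adj b d) (hda : B.Adj d a ∧ ¬ R.Adj d a) :
    HasDoubleC5 B R := by
  refine ⟨{a, b, c, d, e}, ⟨![a, c, e, b, d], ?_, ?_, ?_, ?_⟩, ⟨![a, b, c, d, e], ?_, ?_, ?_, ?_⟩⟩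
  · have := hab.1.ne; have := hbc.1.ne; have := hcd.1.ne; have := hde.1.ne; have := hea.1.ne
    have := hac.1.ne; have := hce.1.ne; have := heb.1.ne; have := hbd.1.ne; have := hda.1.ne
    intro i j h
    fin_cases i <;> fin_cases j <;> simp_all
  · ext x
    simp
    tauto
  · intro i
    fin_cases i <;> simp [*]
  · intro i
    fin_cases i
    exacts [mt B.adj_symm hea.2, mt B.adj_symm hbc.2, mt B.adj_symm hde.2, mt B.adj_symm hab.2,
      mt B.adj_symm hcd.2]
  · have := hab.1.ne; have := hbc.1.ne; have := hcd.1.ne; have := hde.1.ne; have := hea.1.ne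
    have := hac.1.ne; have := hce.1.ne; have := heb.1.ne; have := hbd.1.ne; have := hda.1.ne
    intro i j h
    fin_cases i <;> fin_cases j <;> simp_all
  · ext x
    simp
    tauto
  · intro i
    fin_cases i <;> simp [*]
  · intro i
    fin_cases i
    exacts [hac.2, hbd.2, hce.2, hda.2, heb.2]

/-- A vertex outside the configuration that is not `R`-adjacent to `v₂` is `B`-adjacent to
`v₁`, `v₄` and `v₅`. -/
theorem adj_of_not_adj_second {V : Type*} {B R : SimpleGraph V}
    (hB4 : IsC4Free B) (hR4 : IsC4Free R) (hcomplete : ∀ x y, x ≠ y → B.Adj x y ∨ R.Adj x y)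
    (hnoDouble : ¬ HasDoubleC5 B R) {v₁ v₂ v₃ v₄ v₅ u : V}
    (h12 : R.Adj v₁ v₂ ∧ ¬ B.Adj v₁ v₂) (h23 : R.Adj v₂ v₃ ∧ ¬ B.Adj v₂ v₃)
    (h34 : R.Adj v₃ v₄ ∧ ¬ B.Adj v₃ v₄) (h13 : B.Adj v₁ v₃ ∧ ¬ R.Adj v₁ v₃)
    (h35 : B.Adj v₃ v₅) (h52 : B.Adj v₅ v₂)
    (h24 : B.Adj v₂ v₄ ∧ ¬ R.Adj v₂ v₄) (h41 : B.Adj v₄ v₁ ∧ ¬ R.Adj v₄ v₁)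
    (h51 : B.Adj v₅ v₁)
    (h1 : u ≠ v₁) (h2 : u ≠ v₂) (h3 : u ≠ v₃) (h4 : u ≠ v₄) (h5 : u ≠ v₅)
    (hu2 : ¬ R.Adj u v₂) :
    B.Adj u v₁ ∧ B.Adj u v₄ ∧ B.Adj u v₅ := by
  have bu2 : B.Adj u v₂ := (hcomplete u v₂ h2).resolve_right hu2
  by_cases bu3 : B.Adj u v₃
  · have bu5 : B.Adj u v₅ :=
      (hB4.adj_of_cycle h23.1.ne h5.symm h52.symm h35.symm bu3.symm bu2 h23.2).symm
    have h14 : B.Adj u v₁ → B.Adj u v₄ := fun h =>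
      hB4.adj_of_cycle h12.1.ne h4 h.symm bu2 h24.1 h41.1 h12.2
    have h41' : B.Adj u v₄ → B.Adj u v₁ := fun h =>
      hB4.adj_of_cycle h34.1.ne h1 bu3.symm h h41.1 h13.1 h34.2
    by_cases bu1 : B.Adj u v₁
    · exact ⟨bu1, h14 bu1, bu5⟩
    · have bu4 : ¬ B.Adj u v₄ := fun h => bu1 (h41' h)
      have ru1 : R.Adj u v₁ := (hcomplete u v₁ h1).resolve_left bu1
      have ru4 : R.Adj u v₄ := (hcomplete u v₄ h4).resolve_left bu4
      have ru3 : ¬ R.Adj u v₃ := fun h =>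
        hu2 (hR4.adj_of_cycle h13.1.ne h2 ru1.symm h h23.1.symm h12.1.symm h13.2)
      exact absurd (hasDoubleC5_of_adj h12 h23 h34 ⟨ru4.symm, fun h => bu4 h.symm⟩ ⟨ru1, bu1⟩
        h13 ⟨bu3.symm, fun h => ru3 h.symm⟩ ⟨bu2, hu2⟩ h24 h41) hnoDouble
  · have ru3 : R.Adj u v₃ := (hcomplete u v₃ h3).resolve_left bu3
    have ru1 : ¬ R.Adj u v₁ := fun h =>
      hu2 (hR4.adj_of_cycle h13.1.ne h2 h.symm ru3 h23.1.symm h12.1.symm h13.2)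
    have bu1 : B.Adj u v₁ := (hcomplete u v₁ h1).resolve_right ru1
    exact ⟨bu1, hB4.adj_of_cycle h12.1.ne h4 bu1.symm bu2 h24.1 h41.1 h12.2,
      hB4.adj_of_cycle h12.1.ne h5 bu1.symm bu2 h52.symm h51 h12.2⟩

theorem stmt_12 {V : Type*} [Fintype V] (B R : SimpleGraph V)
    (hB4 : IsC4Free B) (hR4 : IsC4Free R)
    (hcomplete : B ⊔ R = ⊤)
    (hnoDouble : ¬ HasDoubleC5 B R)
    (v₁ v₂ v₃ v₄ v₅ : V)
    (hdist : [v₁, v₂, v₃, v₄, v₅].Pairwise (· ≠ ·))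
    (h12 : R.Adj v₁ v₂ ∧ ¬ B.Adj v₁ v₂)
    (h23 : R.Adj v₂ v₃ ∧ ¬ B.Adj v₂ v₃)
    (h34 : R.Adj v₃ v₄ ∧ ¬ B.Adj v₃ v₄)
    (h13 : B.Adj v₁ v₃ ∧ ¬ R.Adj v₁ v₃)
    (h35 : B.Adj v₃ v₅ ∧ ¬ R.Adj v₃ v₅)
    (h52 : B.Adj v₅ v₂ ∧ ¬ R.Adj v₅ v₂)
    (h24 : B.Adj v₂ v₄ ∧ ¬ R.Adj v₂ v₄)
    (h41 : B.Adj v₄ v₁ ∧ ¬ R.Adj v₄ v₁)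
    (h45 : B.Adj v₄ v₅) (h51 : B.Adj v₅ v₁)
    (A : Set V)
    (hA : A = {u : V | u ∉ ({v₁, v₂, v₃, v₄, v₅} : Set V) ∧
      ¬ (R.Adj u v₂ ∧ R.Adj u v₃)}) :
    B.IsClique (A ∪ {v₁, v₄, v₅}) := by
  have hBR : ∀ x y, x ≠ y → B.Adj x y ∨ R.Adj x y := fun x y h => by
    rw [← SimpleGraph.sup_adj, hcomplete]
    exact h
  have key : ∀ u ∈ A, B.Adj u v₁ ∧ B.Adj u v₄ ∧ B.Adj u v₅ := by
    intro u hu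
    simp only [hA, Set.mem_ofPred_eq, Set.mem_insert_iff, Set.mem_singleton_iff, not_or] at hu
    obtain ⟨⟨h1, h2, h3, h4, h5⟩, hu⟩ := hu
    by_cases hu2 : R.Adj u v₂
    · have hu3 : ¬ R.Adj u v₃ := fun h => hu ⟨hu2, h⟩
      have := adj_of_not_adj_second hB4 hR4 hBR hnoDouble (v₁ := v₄) (v₂ := v₃) (v₃ := v₂)
        (v₄ := v₁) (v₅ := v₅) (by simpa [B.adj_comm, R.adj_comm] using h34)
        (by simpa [B.adj_comm, R.adj_comm] using h23) (by simpa [B.adj_comm, R.adj_comm] using h12)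
        (by simpa [B.adj_comm, R.adj_comm] using h24) h52.1.symm h35.1.symm
        (by simpa [B.adj_comm, R.adj_comm] using h13) (by simpa [B.adj_comm, R.adj_comm] using h41)
        h45.symm h4 h3 h2 h1 h5 hu3
      exact ⟨this.2.1, this.1, this.2.2⟩
    · exact adj_of_not_adj_second hB4 hR4 hBR hnoDouble h12 h23 h34 h13 h35.1 h52.1 h24 h41 h51
        h1 h2 h3 h4 h5 hu2
  have pair : ∀ u ∈ A, ∀ w ∈ A, u ≠ w → B.Adj u w := by
    intro u hu w hw huw
    by_contra hn
    obtain ⟨u1, u4, -⟩ := key u hu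
    obtain ⟨w1, w4, -⟩ := key w hw
    have both2 : B.Adj u v₂ → ¬ B.Adj w v₂ := fun a b =>
      h12.2 (hB4.adj_of_cycle huw h12.1.ne u1 w1.symm b a.symm hn)
    have both3 : B.Adj u v₃ → ¬ B.Adj w v₃ := fun a b =>
      h34.2 (hB4.adj_of_cycle huw h34.1.ne a b.symm w4 u4.symm hn)
    have ruw : R.Adj u w := (hBR u w huw).resolve_left hn
    simp only [hA, Set.mem_ofPred_eq, Set.mem_insert_iff, Set.mem_singleton_iff, not_or] at hu hw
    obtain ⟨⟨-, hu2, hu3, -⟩, hu⟩ := hu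
    obtain ⟨⟨-, hw2, hw3, -⟩, hw⟩ := hw
    have cu2 := hBR u v₂ hu2
    have cu3 := hBR u v₃ hu3
    have cw2 := hBR w v₂ hw2
    have cw3 := hBR w v₃ hw3
    have cyc1 : R.Adj u v₃ → R.Adj w v₂ → ¬ R.Adj u v₂ → R.Adj w v₃ := fun a b c =>
      (hR4.adj_of_cycle hu2 (Ne.symm hw3) a h23.1.symm b.symm ruw.symm c).symm
    have cyc2 : R.Adj u v₂ → R.Adj w v₃ → ¬ R.Adj u v₃ → R.Adj w v₂ := fun a b c =>
      (hR4.adj_of_cycle hu3 (Ne.symm hw2) a h23.1 b.symm ruw.symm c).symm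
    grind
  rintro x (hx | hx) y (hy | hy) hxy
  · exact pair x hx y hy hxy
  · obtain ⟨a, b, c⟩ := key x hx
    obtain rfl | rfl | rfl := hy <;> assumption
  · obtain ⟨a, b, c⟩ := key y hy
    obtain rfl | rfl | rfl := hx <;> exact SimpleGraph.Adj.symm ‹_›
  · have := h41.1.symm
    have := h45.symm
    have := h51.symm
    obtain rfl | rfl | rfl := hx <;> obtain rfl | rfl | rfl := hy <;>
      first | exact absurd rfl hxy | assumption | exact h41.1
end

section
/- Let B and R be C4-free simple graphs on the same finite vertex set V with G(B,R) the complete graph on V, and let v1, v2, v3, v4, v5 be a double C5 with blue edges and red diagonals. Let N be the set of vertices p ∈ V \ {v1,...,v5} that are R-adjacent to all of v1,...,v5, and for each index j (mod 5), let A_j be the set of vertices p ∈ V \ {v1,...,v5} such that pv_j is an edge of both B and R, p is adjacent in B but not in R to v_{j-1} and v_{j+1}, and p is adjacent in R but not in B to v_{j-2} and v_{j+2}. Then N ∪ A_3 ∪ A_5 ∪ {v3, v5} is a clique of R. -/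
/-- In a `C4`-free graph, two distinct common neighbours of a non-adjacent pair are adjacent. -/
theorem IsC4Free.adj_of_common_neighbors {V : Type*} {G : SimpleGraph V} (hG : IsC4Free G)
    {p q x y : V} (hpq : p ≠ q) (hxy : x ≠ y) (hn : ¬ G.Adj x y)
    (hpx : G.Adj p x) (hpy : G.Adj p y) (hqx : G.Adj q x) (hqy : G.Adj q y) : G.Adj p q := by
  by_contra h
  exact hG ⟨p, x, q, y, hpq, hxy, hpx, hqx.symm, hqy, hpy.symm, h, hn⟩

theorem stmt_18 {V : Type*} [Fintype V] (B R : SimpleGraph V)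
    (hB4 : IsC4Free B) (hR4 : IsC4Free R)
    (hcomplete : B ⊔ R = ⊤)
    -- a double C5 with blue edges and red diagonals
    (v : Fin 5 → V) (hv : Function.Injective v)
    (hblue : ∀ i, B.Adj (v i) (v (i + 1)) ∧ ¬ R.Adj (v i) (v (i + 1)))
    (hred : ∀ i, R.Adj (v i) (v (i + 2)) ∧ ¬ B.Adj (v i) (v (i + 2)))
    (N : Set V)
    (hN : N = {p : V | p ∉ Set.range v ∧ ∀ i, R.Adj p (v i)})
    (A : Fin 5 → Set V)
    (hA : ∀ j, A j = {p : V | p ∉ Set.range v ∧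
      B.Adj p (v j) ∧ R.Adj p (v j) ∧
      (B.Adj p (v (j + 1)) ∧ ¬ R.Adj p (v (j + 1))) ∧
      (B.Adj p (v (j - 1)) ∧ ¬ R.Adj p (v (j - 1))) ∧
      (R.Adj p (v (j + 2)) ∧ ¬ B.Adj p (v (j + 2))) ∧
      (R.Adj p (v (j - 2)) ∧ ¬ B.Adj p (v (j - 2)))}) :
    R.IsClique (N ∪ A 2 ∪ A 4 ∪ {v 2, v 4}) := by
  have hne : ∀ i j, i ≠ j → v i ≠ v j := fun i j hij h => hij (hv h)
  have hN' : ∀ p ∈ N, ∀ i, R.Adj p (v i) := by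
    intro p hp
    rw [hN] at hp
    exact hp.2
  have hA2 : ∀ p ∈ A 2, p ∉ Set.range v ∧ R.Adj p (v 0) ∧ ¬ B.Adj p (v 0) ∧ B.Adj p (v 1) ∧
      R.Adj p (v 2) ∧ R.Adj p (v 4) := by
    intro p hp
    rw [hA] at hp
    obtain ⟨h, -, h2, -, h1, h4, h0⟩ := hp
    exact ⟨h, h0.1, h0.2, h1.1, h2, h4.1⟩
  have hA4 : ∀ p ∈ A 4, p ∉ Set.range v ∧ R.Adj p (v 1) ∧ ¬ B.Adj p (v 1) ∧ B.Adj p (v 0) ∧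
      R.Adj p (v 2) ∧ R.Adj p (v 4) := by
    intro p hp
    rw [hA] at hp
    obtain ⟨h, -, h4, h0, -, h1, h2⟩ := hp
    exact ⟨h, h1.1, h1.2, h0.1, h2.1, h4⟩
  have adj_of_zero_four : ∀ p q, p ≠ q → R.Adj p (v 4) → R.Adj p (v 0) →
      R.Adj q (v 4) → R.Adj q (v 0) → R.Adj p q := fun p q hpq =>
    hR4.adj_of_common_neighbors hpq (hne 4 0 (by decide)) (hblue 4).2
  have adj_of_one_two : ∀ p q, p ≠ q → R.Adj p (v 1) → R.Adj p (v 2) →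
      R.Adj q (v 1) → R.Adj q (v 2) → R.Adj p q := fun p q hpq =>
    hR4.adj_of_common_neighbors hpq (hne 1 2 (by decide)) (hblue 1).2
  have adj_A2_A4 : ∀ p ∈ A 2, ∀ q ∈ A 4, p ≠ q → R.Adj p q := by
    intro p hp q hq hpq
    obtain ⟨hpv, -, hp0, hp1, -⟩ := hA2 p hp
    obtain ⟨hqv, -, hq1, hq0, -⟩ := hA4 q hq
    by_contra hR
    have hB : B.Adj p q := by
      have h : (B ⊔ R).Adj p q := by rw [hcomplete]; exact hpq
      exact h.resolve_right hR
    exact hB4 ⟨p, q, v 0, v 1, fun h => hpv ⟨0, h.symm⟩, fun h => hqv ⟨1, h.symm⟩,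
      hB, hq0, (hblue 0).1, hp1.symm, hp0, hq1⟩
  have h24 : R.Adj (v 2) (v 4) := (hred 2).1
  rintro p (((hp | hp) | hp) | rfl | rfl) q (((hq | hq) | hq) | rfl | rfl) hpq <;>
    grind [SimpleGraph.Adj.symm]
end
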